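/- Let C be the 4-ary relation on ℝ defined by C(x,y,z,w) ⟺ (x < y < 0 < z < w and x·z = y·w), and let R_C denote the first-order structure (ℝ, ≤, C). Then: (a) R_C is o-minimal; (b) the family S = { {(x,y) ∈ ℝ² : y < 0 and x > t} : t ∈ ℝ } is a ∅-definable downward directed family of subsets of ℝ²; and (c) whenever S' is a definable downward directed family of subsets of ℝ² that is finer than S and generates a complete 2-type p over R_C (i.e., S' is complete), neither S' nor p is ∅-definable in R_C. -/

import Mathlib

open FirstOrder Set

/-- `M` is an o-minimal `L`-structure: a densely linearly ordered structure without endpoints,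
whose order is `∅`-definable, and in which every definable (with parameters) subset of `M`
is a finite union of points and open intervals with endpoints in `M ∪ {±∞}`. -/
def IsOMinimal (L : FirstOrder.Language) (M : Type*) [L.Structure M] [LinearOrder M] : Prop :=
  Nonempty M ∧ DenselyOrdered M ∧ NoMinOrder M ∧ NoMaxOrder M ∧
  Set.Definable (∅ : Set M) L {v : Fin 2 → M | v 0 < v 1} ∧
  ∀ s : Set M, Set.Definable₁ (Set.univ : Set M) L s →
    ∃ F : Finset (Set M), s = ⋃₀ (F : Set (Set M)) ∧
      ∀ t ∈ F, (∃ a : M, t = {a}) ∨ (∃ a b : M, t = Set.Ioo a b) ∨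
        (∃ a : M, t = Set.Ioi a) ∨ (∃ a : M, t = Set.Iio a) ∨ t = Set.univ

/-- The fiber over `u` of a set `D ⊆ M^{m+n}`, i.e. the set `φ(u, M^n)`. -/
def famFiber {M : Type*} {m n : ℕ} (D : Set (Fin m ⊕ Fin n → M)) (u : Fin m → M) :
    Set (Fin n → M) :=
  {v | Sum.elim u v ∈ D}

/-- An `A`-definable family of subsets of `M^n`: the family of fibers `φ(u, M^n)` for `u`
ranging over an `A`-definable index set `Ω`, where `φ` is `A`-definable. -/
def IsDefFamily (L : FirstOrder.Language) {M : Type*} [L.Structure M] (A : Set M) (n : ℕ)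
    (S : Set (Set (Fin n → M))) : Prop :=
  ∃ (m : ℕ) (Ω : Set (Fin m → M)) (D : Set (Fin m ⊕ Fin n → M)),
    Set.Definable A L Ω ∧ Set.Definable A L D ∧ S = famFiber D '' Ω

/-- A family of sets is downward directed: it does not contain `∅` and any two members
contain a common member. -/
def DirectedFam {α : Type*} (S : Set (Set α)) : Prop :=
  ∅ ∉ S ∧ ∀ X ∈ S, ∀ Y ∈ S, ∃ Z ∈ S, Z ⊆ X ∩ Y

/-- `S` is finer than `F`: every member of `F` contains a member of `S`. -/
def FinerThan {α : Type*} (S F : Set (Set α)) : Prop :=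
  ∀ X ∈ F, ∃ Y ∈ S, Y ⊆ X

/-- A (complete) `n`-type over `M`: an ultrafilter on the Boolean algebra of definable
subsets of `M^n`. -/
def IsTypeOn (L : FirstOrder.Language) {M : Type*} [L.Structure M] (n : ℕ)
    (p : Set (Set (Fin n → M))) : Prop :=
  (∀ X ∈ p, Set.Definable (Set.univ : Set M) L X) ∧
  ∅ ∉ p ∧
  (∀ X ∈ p, ∀ Y ∈ p, X ∩ Y ∈ p) ∧
  (∀ X ∈ p, ∀ Y : Set (Fin n → M), Set.Definable (Set.univ : Set M) L Y → X ⊆ Y → Y ∈ p) ∧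
  (∀ X : Set (Fin n → M), Set.Definable (Set.univ : Set M) L X → X ∈ p ∨ Xᶜ ∈ p)

/-- A type `p` is `A`-definable if for every `∅`-definable `D ⊆ M^{m+n}` the set of
parameters `u` with `φ(u, M^n) ∈ p` is `A`-definable. -/
def IsDefTypeOver (L : FirstOrder.Language) {M : Type*} [L.Structure M] (A : Set M) (n : ℕ)
    (p : Set (Set (Fin n → M))) : Prop :=
  ∀ (m : ℕ) (D : Set (Fin m ⊕ Fin n → M)), Set.Definable (∅ : Set M) L D →
    Set.Definable A L {u : Fin m → M | famFiber D u ∈ p}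

/-- A family `F` is complete for a family `X` if each member of `X` either contains a member
of `F` or is disjoint from one. -/
def CompleteFor {α : Type*} (F X : Set (Set α)) : Prop :=
  ∀ Y ∈ X, ∃ Z ∈ F, Z ⊆ Y ∨ Z ∩ Y = ∅

/-- A family of subsets of `M^n` is complete if it decides every definable set. -/
def IsCompleteFam (L : FirstOrder.Language) {M : Type*} [L.Structure M] (n : ℕ)
    (S : Set (Set (Fin n → M))) : Prop :=
  ∀ X : Set (Fin n → M), Set.Definable (Set.univ : Set M) L X → ∃ Z ∈ S, Z ⊆ X ∨ Z ∩ X = ∅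

/-- `B` is a basis for the type `p`: a downward directed subfamily generating `p`. -/
def IsBasisOfType {α : Type*} (B p : Set (Set α)) : Prop :=
  B ⊆ p ∧ DirectedFam B ∧ ∀ Y ∈ p, ∃ Z ∈ B, Z ⊆ Y

/-- `p` has an `A`-definable basis. -/
def HasDefBasis (L : FirstOrder.Language) {M : Type*} [L.Structure M] (A : Set M) (n : ℕ)
    (p : Set (Set (Fin n → M))) : Prop :=
  ∃ B, IsDefFamily L A n B ∧ IsBasisOfType B p

/-- `S` has a finite tame transversal: it is covered by finitely many subfamilies, each of
which extends to a definable type. -/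
def HasFTT (L : FirstOrder.Language) {M : Type*} [L.Structure M] (n : ℕ)
    (S : Set (Set (Fin n → M))) : Prop :=
  ∃ (N : ℕ) (p : Fin N → Set (Set (Fin n → M))),
    (∀ i, IsTypeOn L n (p i) ∧ IsDefTypeOver L (Set.univ : Set M) n (p i)) ∧
    ∀ X ∈ S, ∃ i, X ∈ p i

/-- The `(m,n)`-property: among any `m` members of the family, some `n` have nonempty
intersection. -/
def HasMNProperty {α : Type*} (S : Set (Set α)) (m n : ℕ) : Prop :=
  ∀ F : Finset (Set α), ↑F ⊆ S → F.card = m →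
    ∃ G ⊆ F, G.card = n ∧ (⋂₀ (G : Set (Set α))).Nonempty

/-- The language of `(ℝ, ≤, C)`: one binary relation and one 4-ary relation. -/
def LC : FirstOrder.Language where
  Functions := fun _ => Empty
  Relations := fun n =>
    match n with
    | 2 => Unit
    | 4 => Unit
    | _ => Empty

/-- The structure `(ℝ, ≤, C)`, where
`C(x,y,z,w) ↔ (x < y < 0 < z < w ∧ x·z = y·w)`. -/
noncomputable instance LC.structureR : LC.Structure ℝ where
  funMap := fun {n} f _ => Empty.elim f
  RelMap := fun {n} r v =>
    match n, r, v with
    | 2, _, v => v 0 ≤ v 1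
    | 4, _, v => v 0 < v 1 ∧ v 1 < 0 ∧ 0 < v 2 ∧ v 2 < v 3 ∧ v 0 * v 2 = v 1 * v 3
    | 0, r, _ => Empty.elim r
    | 1, r, _ => Empty.elim r
    | 3, r, _ => Empty.elim r
    | (_ + 5), r, _ => Empty.elim r


namespace S19
open FirstOrder.Language

def CRel (x y z w : ℝ) : Prop := x < y ∧ y < 0 ∧ 0 < z ∧ z < w ∧ x * z = y * w

def rle : LC.Relations 2 := ()
def rC : LC.Relations 4 := ()

lemma relMap_rle (v : Fin 2 → ℝ) : Structure.RelMap rle v ↔ v 0 ≤ v 1 := Iff.rfl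
lemma relMap_rC (v : Fin 4 → ℝ) : Structure.RelMap rC v ↔ CRel (v 0) (v 1) (v 2) (v 3) := Iff.rfl

section
variable {A : Set ℝ} {α : Type*}

lemma def_le {f g : (α → ℝ) → ℝ} (hf : A.DefinableFun LC f) (hg : A.DefinableFun LC g) :
    A.Definable LC {v | f v ≤ g v} := by
  have h0 : (∅ : Set ℝ).Definable LC {v : Fin 2 → ℝ | v 0 ≤ v 1} := by
    rw [Set.empty_definable_iff]
    refine ⟨Relations.formula rle ![Term.var 0, Term.var 1], ?_⟩
    ext v
    simp [Formula.realize_rel, relMap_rle]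
  have hF : A.DefinableMap LC (fun v => ![f v, g v]) := by
    simp [DefinableMap, *]
  exact (h0.mono (Set.empty_subset A)).preimage_map hF

lemma def_C {f g h k : (α → ℝ) → ℝ} (hf : A.DefinableFun LC f) (hg : A.DefinableFun LC g)
    (hh : A.DefinableFun LC h) (hk : A.DefinableFun LC k) :
    A.Definable LC {v | CRel (f v) (g v) (h v) (k v)} := by
  have h0 : (∅ : Set ℝ).Definable LC {v : Fin 4 → ℝ | CRel (v 0) (v 1) (v 2) (v 3)} := by
    rw [Set.empty_definable_iff]
    refine ⟨Relations.formula rC ![Term.var 0, Term.var 1, Term.var 2, Term.var 3], ?_⟩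
    ext v
    simp [Formula.realize_rel, relMap_rC]
  have hF : A.DefinableMap LC (fun v => ![f v, g v, h v, k v]) := by
    intro i
    fin_cases i <;> simpa
  exact (h0.mono (Set.empty_subset A)).preimage_map hF

lemma def_not {P : (α → ℝ) → Prop} (h : A.Definable LC {v | P v}) :
    A.Definable LC {v | ¬ P v} := h.compl
lemma def_and {P Q : (α → ℝ) → Prop} (h : A.Definable LC {v | P v})
    (h' : A.Definable LC {v | Q v}) : A.Definable LC {v | P v ∧ Q v} := h.inter h'
lemma def_or {P Q : (α → ℝ) → Prop} (h : A.Definable LC {v | P v})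
    (h' : A.Definable LC {v | Q v}) : A.Definable LC {v | P v ∨ Q v} := h.union h'

lemma def_lt {f g : (α → ℝ) → ℝ} (hf : A.DefinableFun LC f) (hg : A.DefinableFun LC g) :
    A.Definable LC {v | f v < g v} := by
  simpa only [not_le] using def_not (def_le hg hf)

lemma def_neg {f : (α → ℝ) → ℝ} (hf : A.DefinableFun LC f) :
    A.Definable LC {v | f v < 0} := by
  have h0 : (∅ : Set ℝ).Definable LC {v : Fin 1 → ℝ | v 0 < 0} := by
    have := Definable.exists_of_finite (α := Fin 1) (β := Fin 3)
      (def_C (A := (∅ : Set ℝ)) (α := Fin 1 ⊕ Fin 3) (f := fun v => v (Sum.inr 0))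
        (g := fun v => v (Sum.inl 0)) (h := fun v => v (Sum.inr 1))
        (k := fun v => v (Sum.inr 2)) (by fun_prop) (by fun_prop) (by fun_prop) (by fun_prop))
    convert this using 1
    ext v
    simp only [Set.mem_ofPred_eq, Sum.elim_inr, Sum.elim_inl]
    constructor
    · intro h
      exact ⟨![2 * v 0, 1, 2], by simp; linarith, h, by simp, by simp, by simp; ring⟩
    · rintro ⟨u, h⟩
      exact h.2.1
  have hF : A.DefinableMap LC (fun v => fun _ : Fin 1 => f v) := by
    simp [DefinableMap, *]
  exact (h0.mono (Set.empty_subset A)).preimage_map hF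

/-- Product of positive reals (junk value `1`). -/
noncomputable def pmul (x y : ℝ) : ℝ := open Classical in if 0 < x ∧ 0 < y then x * y else 1

noncomputable def pneg (y : ℝ) : ℝ := open Classical in if y < 0 then -y else 1

lemma pmul_eq {x y : ℝ} (hx : 0 < x) (hy : 0 < y) : pmul x y = x * y := by
  simp [pmul, hx, hy]
lemma pneg_eq {x : ℝ} (hx : x < 0) : pneg x = - x := by
  simp [pneg, hx]

/-- `x z = y w` for `x, y` negative and `z, w` positive. -/
def ERel (x y z w : ℝ) : Prop := CRel x y z w ∨ CRel y x w z ∨ (x = y ∧ x < 0 ∧ z = w ∧ 0 < z)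

lemma ERel_iff {x y z w : ℝ} : ERel x y z w ↔ x < 0 ∧ y < 0 ∧ 0 < z ∧ 0 < w ∧ x * z = y * w := by
  unfold ERel CRel
  constructor
  · rintro (h | h | h)
    · exact ⟨by linarith, by linarith, by linarith, by linarith, by linarith⟩
    · exact ⟨by linarith, by linarith, by linarith, by linarith, by linarith⟩
    · obtain ⟨rfl, h1, rfl, h2⟩ := h
      exact ⟨h1, h1, h2, h2, rfl⟩
  · rintro ⟨h1, h2, h3, h4, h5⟩
    rcases lt_trichotomy x y with h | h | h
    · exact Or.inl ⟨h, h2, h3, by nlinarith, h5⟩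
    · subst h
      right; right
      exact ⟨rfl, h1, mul_left_cancel₀ h1.ne h5, h3⟩
    · exact Or.inr (Or.inl ⟨h, h1, h4, by nlinarith, h5.symm⟩)

end

section
variable {α : Type*}
local notation "U" => (Set.univ : Set ℝ)

lemma def_const (a : ℝ) : (U).DefinableFun LC (fun _ : α → ℝ => a) :=
  LC.definableFun_const α (Set.mem_univ a)

lemma def_E {f g h k : (α → ℝ) → ℝ} (hf : (U).DefinableFun LC f) (hg : (U).DefinableFun LC g)
    (hh : (U).DefinableFun LC h) (hk : (U).DefinableFun LC k) :
    (U).Definable LC {v | ERel (f v) (g v) (h v) (k v)} := by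
  unfold ERel
  exact def_or (def_C hf hg hh hk) (def_or (def_C hg hf hk hh) (def_and (hf.ofPred_eq hg)
    (def_and (def_lt hf (def_const 0)) (def_and (hh.ofPred_eq hk) (def_lt (def_const 0) hh)))))

lemma defFun_pneg {f : (α → ℝ) → ℝ} (hf : (U).DefinableFun LC f) :
    (U).DefinableFun LC (fun v => pneg (f v)) := by
  have h0 : (U).DefinableFun LC (fun v : Fin 1 → ℝ => pneg (v 0)) := by
    unfold DefinableFun
    have h1 : (U).Definable LC {w : Option (Fin 1) → ℝ |
        ERel (w (some 0)) (-1) 1 (w none) ∨ (¬ (w (some 0) < 0) ∧ w none = 1)} :=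
      def_or (def_E (by fun_prop) (def_const _) (def_const _) (by fun_prop))
        (def_and (def_not (def_lt (by fun_prop) (def_const _)))
          (DefinableFun.ofPred_eq (by fun_prop) (def_const _)))
    convert h1 using 1
    ext w
    simp only [Function.tupleGraph, Set.mem_ofPred_eq, ERel_iff, pneg, Function.comp]
    split_ifs with h
    · constructor
      · intro h2; left; exact ⟨h, by norm_num, by norm_num, by linarith, by linarith⟩
      · rintro (h2 | h2)
        · linarith
        · exact absurd h h2.1
    · constructor
      · intro h2; right; exact ⟨h, h2.symm⟩
      · rintro (h2 | h2)
        · exact absurd h2.1 h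
        · exact h2.2.symm
  exact DefinableFun.comp (g := fun v => fun _ : Fin 1 => f v) (fun i => hf) h0

lemma defFun_pmul {f g : (α → ℝ) → ℝ} (hf : (U).DefinableFun LC f)
    (hg : (U).DefinableFun LC g) :
    (U).DefinableFun LC (fun v => pmul (f v) (g v)) := by
  have h0 : (U).DefinableFun LC (fun v : Fin 2 → ℝ => pmul (v 0) (v 1)) := by
    unfold DefinableFun
    have h2 := Definable.exists_of_finite (α := Option (Fin 2)) (β := Fin 1) (def_and
      (def_E (α := Option (Fin 2) ⊕ Fin 1) (f := fun v => v (Sum.inr 0)) (g := fun v => -1)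
        (h := fun v => v (Sum.inl (some 0))) (k := fun v => v (Sum.inl none))
        (by fun_prop) (def_const _) (by fun_prop) (by fun_prop))
      (def_E (α := Option (Fin 2) ⊕ Fin 1) (f := fun v => v (Sum.inr 0)) (g := fun v => -1)
        (h := fun v => 1) (k := fun v => v (Sum.inl (some 1)))
        (by fun_prop) (def_const _) (def_const _) (by fun_prop)))
    have h1 := def_or h2 (def_and (def_not (def_and (def_lt (def_const 0) 
          (DefinableFun.proj LC (i := some 0)))
          (def_lt (def_const 0) (DefinableFun.proj LC (i := some 1)))))
          (DefinableFun.ofPred_eq (DefinableFun.proj LC (i := none)) (def_const 1)))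
    convert h1 using 1
    ext w
    simp only [Function.tupleGraph, Set.mem_ofPred_eq, ERel_iff, pmul, Function.comp, Sum.elim_inl,
      Sum.elim_inr]
    split_ifs with h
    · constructor
      · intro h2
        left
        have := mul_pos h.1 h.2
        exact ⟨fun _ => - w (some 1), ⟨by simpa using h.2, by norm_num, h.1, by linarith, by
          linarith⟩, by simpa using h.2, by norm_num, by norm_num, h.2, by ring⟩
      · rintro (⟨u, h2, h3⟩ | h2)
        · have : u 0 = - w (some 1) := by linarith [h3.2.2.2.2]
          have h4 := h2.2.2.2.2
          rw [this] at h4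
          linarith
        · exact absurd h h2.1
    · constructor
      · intro h2; right; exact ⟨h, h2.symm⟩
      · rintro (⟨u, h2, h3⟩ | h2)
        · exact absurd ⟨h2.2.2.1, h3.2.2.2.1⟩ h
        · exact h2.2.symm
  exact DefinableFun.comp (g := fun v => ![f v, g v])
    (fun i => by fin_cases i <;> simpa) h0

noncomputable def ppow (x : ℝ) : ℕ → ℝ
  | 0 => 1
  | n + 1 => pmul (ppow x n) x

lemma ppow_eq {x : ℝ} (hx : 0 < x) (n : ℕ) : ppow x n = x ^ n := by
  induction n with
  | zero => simp [ppow]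
  | succ n ih => rw [ppow, ih, pmul_eq (by positivity) hx, pow_succ]

lemma defFun_ppow {f : (α → ℝ) → ℝ} (hf : (U).DefinableFun LC f) (n : ℕ) :
    (U).DefinableFun LC (fun v => ppow (f v) n) := by
  induction n with
  | zero => exact def_const 1
  | succ n ih => exact defFun_pmul ih hf

/-- The half planes in logarithmic coordinates. -/
def HP (k : ℚ) (q : ℝ) : Set (Fin 2 → ℝ) :=
  {v | v 1 < 0 ∧ 0 < v 0 ∧ q < Real.log (- v 1) - k * Real.log (v 0)}

lemma def_HP (k : ℚ) (q : ℝ) : (U).Definable LC (HP k q) := by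
  -- `k = m / n`, `m = i - j`
  obtain ⟨n, i, j, hn, hk⟩ : ∃ n i j : ℕ, 0 < n ∧ (n : ℝ) * k = (i : ℝ) - j := by
    refine ⟨k.den, k.num.toNat, (-k.num).toNat, k.den_pos, ?_⟩
    have h1 : (k.den : ℝ) * k = (k.num : ℝ) := by
      exact_mod_cast Rat.den_mul_eq_num k
    rw [h1]
    have h2 : k.num = (k.num.toNat : ℤ) - ((-k.num).toNat : ℤ) := by omega
    calc (k.num : ℝ) = (((k.num.toNat : ℤ) - ((-k.num).toNat : ℤ) : ℤ) : ℝ) := by rw [← h2]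
      _ = _ := by push_cast; rfl
  have h1 : (U).Definable LC {v : Fin 2 → ℝ | v 1 < 0 ∧ 0 < v 0 ∧
      pmul (Real.exp (n * q)) (ppow (v 0) i) < pmul (ppow (pneg (v 1)) n) (ppow (v 0) j)} :=
    def_and (def_lt (by fun_prop) (def_const _)) (def_and (def_lt (def_const _) (by fun_prop))
      (def_lt (defFun_pmul (def_const _) (defFun_ppow (by fun_prop) _))
        (defFun_pmul (defFun_ppow (defFun_pneg (by fun_prop)) _) (defFun_ppow (by fun_prop) _))))
  convert h1 using 1
  ext v
  simp only [HP, Set.mem_ofPred_eq]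
  refine and_congr_right fun hy => and_congr_right fun hx => ?_
  have hy' : 0 < - v 1 := by linarith
  rw [pneg_eq hy, ppow_eq hx, ppow_eq hx, ppow_eq hy', pmul_eq (Real.exp_pos _) (by positivity),
    pmul_eq (by positivity) (by positivity), ← Real.log_lt_log_iff (x := Real.exp (n * q) * v 0 ^ i) (by positivity) (by positivity),
    Real.log_mul (by positivity) (by positivity), Real.log_mul (by positivity) (by positivity),
    Real.log_exp, Real.log_pow, Real.log_pow, Real.log_pow]
  have hn' : (0 : ℝ) < n := by exact_mod_cast hn
  rw [← mul_lt_mul_iff_right₀ hn', mul_sub, ← mul_assoc, hk]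
  constructor <;> intro h <;> linarith

end

section semilinear

/-- Same sign. -/
def SS (x y : ℝ) : Prop := (x < 0 ↔ y < 0) ∧ (0 < x ↔ 0 < y)

lemma SS.symm {x y : ℝ} (h : SS x y) : SS y x := ⟨h.1.symm, h.2.symm⟩

lemma SS.eq_zero {x y : ℝ} (h : SS x y) : x = 0 ↔ y = 0 := by
  have h1 := h.1
  have h2 := h.2
  constructor
  · rintro rfl
    simp only [lt_irrefl, false_iff, not_lt] at h1 h2
    linarith
  · rintro rfl
    simp only [lt_irrefl, iff_false, not_lt] at h1 h2
    linarith

lemma SS.mul {x y : ℝ} (h : SS x y) (c : ℝ) : SS (c * x) (c * y) := by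
  rcases lt_trichotomy c 0 with hc | hc | hc
  · unfold SS
    rw [mul_neg_iff, mul_neg_iff, mul_pos_iff, mul_pos_iff]
    have := h.1; have := h.2
    have h3 : ¬ 0 < c := by linarith
    simp_all
  · simp [SS, hc]
  · unfold SS
    rw [mul_neg_iff, mul_neg_iff, mul_pos_iff, mul_pos_iff]
    have := h.1; have := h.2
    have h3 : ¬ c < 0 := by linarith
    simp_all

lemma exists_same_position {I : Type*} (s : Finset I) (r ρ : I → ℝ)
    (h : ∀ i ∈ s, ∀ j ∈ s, SS (r i - r j) (ρ i - ρ j)) (t : ℝ) :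
    ∃ t', ∀ i ∈ s, SS (t - r i) (t' - ρ i) := by
  classical
  by_cases ht : ∃ i ∈ s, r i = t
  · obtain ⟨i, hi, rfl⟩ := ht
    exact ⟨ρ i, fun j hj => h i hi j hj⟩
  · push Not at ht
    obtain ⟨t', h1, h2⟩ := Order.exists_between_finsets
      ((s.filter fun i => r i < t).image ρ) ((s.filter fun i => t < r i).image ρ) (by
        intro x hx y hy
        simp only [Finset.mem_image, Finset.mem_filter] at hx hy
        obtain ⟨i, ⟨hi, hit⟩, rfl⟩ := hx
        obtain ⟨j, ⟨hj, hjt⟩, rfl⟩ := hy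
        have := (h i hi j hj).1.1 (by linarith)
        linarith)
    refine ⟨t', fun i hi => ?_⟩
    rcases lt_or_gt_of_ne (ht i hi) with hlt | hlt
    · have := h1 (ρ i) (Finset.mem_image_of_mem _ (Finset.mem_filter.2 ⟨hi, hlt⟩))
      constructor <;> constructor <;> intro _ <;> linarith
    · have := h2 (ρ i) (Finset.mem_image_of_mem _ (Finset.mem_filter.2 ⟨hi, hlt⟩))
      constructor <;> constructor <;> intro _ <;> linarith

/-- Rational linear functionals. -/
noncomputable def Lin (V : Type*) : Submodule ℚ ((V → ℝ) → ℝ) :=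
  Submodule.span ℚ (Set.range fun (i : V) (v : V → ℝ) => v i)

lemma Lin.coord {V : Type*} (i : V) : (fun v : V → ℝ => v i) ∈ Lin V :=
  Submodule.subset_span ⟨i, rfl⟩

/-- Semilinear sets. -/
def SL {V : Type*} (S : Set (V → ℝ)) : Prop :=
  ∃ F : Finset ((V → ℝ) → ℝ), (∀ f ∈ F, f ∈ Lin V) ∧
    ∀ v w, (∀ f ∈ F, SS (f v) (f w)) → (v ∈ S → w ∈ S)

lemma SL.imp {V : Type*} {P Q : (V → ℝ) → Prop} (hP : SL {v | P v}) (hQ : SL {v | Q v}) :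
    SL {v | P v → Q v} := by
  classical
  obtain ⟨F, hF, hF'⟩ := hP
  obtain ⟨G, hG, hG'⟩ := hQ
  refine ⟨F ∪ G, ?_, ?_⟩
  · intro f hf
    rcases Finset.mem_union.1 hf with h | h
    · exact hF f h
    · exact hG f h
  · intro v w h h1 h2
    exact hG' v w (fun f hf => h f (Finset.mem_union_right _ hf))
      (h1 (hF' w v (fun f hf => (h f (Finset.mem_union_left _ hf)).symm) h2))

lemma SL.const {V : Type*} (p : Prop) : SL {_v : V → ℝ | p} :=
  ⟨∅, by simp, fun _ _ _ h => h⟩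

lemma SL.univ {V : Type*} : SL (Set.univ : Set (V → ℝ)) := SL.const True
lemma SL.empty {V : Type*} : SL (∅ : Set (V → ℝ)) := SL.const False

lemma SL.not {V : Type*} {P : (V → ℝ) → Prop} (hP : SL {v | P v}) : SL {v | ¬ P v} :=
  SL.imp hP (SL.const False)

lemma SL.and {V : Type*} {P Q : (V → ℝ) → Prop} (hP : SL {v | P v}) (hQ : SL {v | Q v}) :
    SL {v | P v ∧ Q v} := by
  have := SL.not (SL.imp hP (SL.not hQ))
  simpa using this

lemma SL.neg {V : Type*} {f : (V → ℝ) → ℝ} (hf : f ∈ Lin V) : SL {v | f v < 0} :=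
  ⟨{f}, by simpa, fun v w h h1 => (h f (by simp)).1.1 h1⟩

lemma SL.zero {V : Type*} {f : (V → ℝ) → ℝ} (hf : f ∈ Lin V) : SL {v | f v = 0} :=
  ⟨{f}, by simpa, fun v w h h1 => (h f (by simp)).eq_zero.1 h1⟩

lemma Lin.ext {V V' : Type*} (e : V' → Option V) {f : (V' → ℝ) → ℝ} (hf : f ∈ Lin V') :
    ∃ (f0 : (V → ℝ) → ℝ) (c : ℚ), f0 ∈ Lin V ∧
      ∀ a t, f (fun i => (e i).elim t a) = f0 a + c * t := by
  induction hf using Submodule.span_induction with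
  | mem f hf =>
    obtain ⟨i, rfl⟩ := hf
    cases hi : e i with
    | none => exact ⟨0, 1, Submodule.zero_mem _, fun a t => by simp [hi]⟩
    | some j => exact ⟨fun v => v j, 0, Lin.coord j, fun a t => by simp [hi]⟩
  | zero => exact ⟨0, 0, Submodule.zero_mem _, fun a t => by simp⟩
  | add f g _ _ h1 h2 =>
    obtain ⟨f0, c, h1, h1'⟩ := h1
    obtain ⟨g0, d, h2, h2'⟩ := h2
    exact ⟨f0 + g0, c + d, Submodule.add_mem _ h1 h2, fun a t => by
      simp only [Pi.add_apply, h1', h2']; push_cast; ring⟩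
  | smul q f _ h1 =>
    obtain ⟨f0, c, h1, h1'⟩ := h1
    exact ⟨q • f0, q * c, Submodule.smul_mem _ _ h1, fun a t => by
      simp only [Pi.smul_apply, h1', Rat.smul_def]; push_cast; ring⟩

lemma SL.all {V V' : Type*} (e : V' → Option V) {S : Set (V' → ℝ)} (hS : SL S) :
    SL {a : V → ℝ | ∀ t : ℝ, (fun i => (e i).elim t a) ∈ S} := by
  classical
  obtain ⟨F, hF, hF'⟩ := hS
  choose! f0 c h0 h1 using fun (f : (V' → ℝ) → ℝ) (hf : f ∈ Lin V') => Lin.ext e hf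
  obtain ⟨r, hrdef⟩ : ∃ r : ((V' → ℝ) → ℝ) → ((V → ℝ) → ℝ),
      ∀ f, r f = (-(1 / c f)) • f0 f := ⟨fun f => (-(1 / c f)) • f0 f, fun _ => rfl⟩
  have hr : ∀ f ∈ F, r f ∈ Lin V := fun f hf => by
    rw [hrdef]; exact Submodule.smul_mem (Lin V) (-(1 / c f)) (h0 f (hF f hf))
  refine ⟨F.image f0 ∪ (F ×ˢ F).image (fun p => r p.1 - r p.2), ?_, ?_⟩
  · intro f hf
    simp only [Finset.mem_union, Finset.mem_image, Finset.mem_product, Prod.exists] at hf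
    rcases hf with ⟨g, hg, rfl⟩ | ⟨g, g', ⟨hg, hg'⟩, rfl⟩
    · exact h0 g (hF g hg)
    · exact Submodule.sub_mem _ (hr g hg) (hr g' hg')
  · intro v w h hv t
    have h2 : ∀ f ∈ F, ∀ g ∈ F, SS (r f w - r g w) (r f v - r g v) := fun f hf g hg =>
      (h (r f - r g) (Finset.mem_union_right _
        (Finset.mem_image.2 ⟨(f, g), Finset.mem_product.2 ⟨hf, hg⟩, rfl⟩))).symm
    obtain ⟨t', ht'⟩ := exists_same_position F (fun f => r f w) (fun f => r f v) h2 t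
    refine hF' _ _ (fun f hf => ?_) (hv t')
    rw [h1 f (hF f hf), h1 f (hF f hf)]
    by_cases hc : c f = 0
    · simp only [hc, Rat.cast_zero, zero_mul, add_zero]
      exact h _ (Finset.mem_union_left _ (Finset.mem_image_of_mem _ hf))
    · have hc' : (c f : ℝ) ≠ 0 := by exact_mod_cast hc
      have := ((ht' f hf).symm).mul (c f)
      have key : ∀ x y, f0 f x + c f * y = c f * (y - r f x) := by
        intro x y
        simp only [hrdef, Pi.smul_apply, Rat.smul_def]
        push_cast
        field_simp
        ring
      rw [key, key]
      exact this

/-- Encoding of reals by signs and logarithms. -/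
noncomputable def enc {V : Type*} (s : V → SignType) (a : V → ℝ) (i : V) : ℝ :=
  (s i : ℝ) * Real.exp (a i)

lemma SL.eq_var {V : Type*} (s : V → SignType) (i j : V) :
    SL {a : V → ℝ | enc s a i = enc s a j} := by
  have key := SL.zero (Submodule.sub_mem _ (Lin.coord i) (Lin.coord j))
  simp only [Pi.sub_apply, sub_eq_zero] at key
  have p := fun x : ℝ => Real.exp_pos x
  have n0 := fun x y : ℝ => (by linarith [p x, p y] : Real.exp x ≠ - Real.exp y)
  have n1 := fun x y : ℝ => (by linarith [p x, p y] : - Real.exp x ≠ Real.exp y)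
  cases hi : s i <;> cases hj : s j <;> simp [enc, hi, hj, n0, n1, SL.univ, SL.empty, key, (p _).ne', (p _).ne]

lemma SL.le_var {V : Type*} (s : V → SignType) (i j : V) :
    SL {a : V → ℝ | enc s a i ≤ enc s a j} := by
  have key := fun i j : V => SL.not (SL.neg (Submodule.sub_mem _ (Lin.coord i) (Lin.coord j)))
  simp only [Pi.sub_apply, not_lt, sub_nonneg] at key
  have p := fun x : ℝ => Real.exp_pos x
  have n0 := fun x y : ℝ => (by linarith [p x, p y] : ¬ Real.exp x ≤ - Real.exp y)
  have n1 := fun x y : ℝ => (by linarith [p x, p y] : - Real.exp x ≤ Real.exp y)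
  have n2 := fun x : ℝ => (by linarith [p x] : ¬ Real.exp x ≤ 0)
  cases hi : s i <;> cases hj : s j <;>
    simp [enc, hi, hj, n0, n1, n2, SL.univ, SL.empty, key, (p _).le]

lemma SL.C_var {V : Type*} (s : V → SignType) (i j k l : V) :
    SL {a : V → ℝ | CRel (enc s a i) (enc s a j) (enc s a k) (enc s a l)} := by
  have p := fun x : ℝ => Real.exp_pos x
  by_cases h : s i = -1 ∧ s j = -1 ∧ s k = 1 ∧ s l = 1
  · obtain ⟨hi, hj, hk, hl⟩ := h
    have e1 := SL.neg (Submodule.sub_mem _ (Lin.coord j) (Lin.coord i))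
    have e2 := SL.neg (Submodule.sub_mem _ (Lin.coord k) (Lin.coord l))
    have e3 := SL.zero (Submodule.sub_mem _ (Submodule.add_mem _ (Lin.coord i) (Lin.coord k))
      (Submodule.add_mem _ (Lin.coord j) (Lin.coord l)))
    have := SL.and e1 (SL.and e2 e3)
    simp only [Pi.sub_apply, Pi.add_apply, sub_neg, sub_eq_zero] at this
    convert this using 3 with a
    simp only [CRel, enc, hi, hj, hk, hl]
    simp [p, ← Real.exp_add]
  · convert SL.const (V := V) False using 3 with a
    simp only [iff_false]
    rintro ⟨h1, h2, h3, h4, -⟩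
    have hneg : ∀ x, enc s a x < 0 → s x = -1 := by
      intro x hx
      unfold enc at hx
      cases hs : s x
      · simp [hs] at hx
      · rfl
      · simp [hs] at hx; linarith [p (a x)]
    have hpos : ∀ x, 0 < enc s a x → s x = 1 := by
      intro x hx
      unfold enc at hx
      cases hs : s x
      · simp [hs] at hx
      · simp [hs] at hx; linarith [p (a x)]
      · rfl
    exact h ⟨hneg _ (h1.trans h2), hneg _ h2, hpos _ h3, hpos _ (h3.trans h4)⟩

lemma term_var {γ : Type*} (t : LC.Term γ) : ∃ i, t = Term.var i := by
  cases t with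
  | var i => exact ⟨i, rfl⟩
  | func f ts => exact Empty.elim f

lemma exists_sign_exp (x : ℝ) : ∃ (σ : SignType) (t : ℝ), x = σ * Real.exp t := by
  rcases lt_trichotomy x 0 with h | h | h
  · exact ⟨-1, Real.log (-x), by rw [Real.exp_log (by linarith)]; simp⟩
  · exact ⟨0, 0, by simp [h]⟩
  · exact ⟨1, Real.log x, by rw [Real.exp_log h]; simp⟩

theorem SL.formula {β : Type*} {n : ℕ} (φ : LC.BoundedFormula β n) :
    ∀ s : β ⊕ Fin n → SignType,
      SL {a | φ.Realize (fun i => enc s a (Sum.inl i)) (fun i => enc s a (Sum.inr i))} := by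
  induction φ with
  | falsum => intro s; exact SL.const False
  | equal t₁ t₂ =>
    intro s
    obtain ⟨i, rfl⟩ := term_var t₁
    obtain ⟨j, rfl⟩ := term_var t₂
    convert SL.eq_var s i j using 3 with a
    cases i <;> cases j <;> simp [BoundedFormula.Realize]
  | @rel n l R ts =>
    intro s
    choose i hi using fun j => term_var (ts j)
    have hr : ∀ (a : _ → ℝ) j, (ts j).realize (Sum.elim (fun i => enc s a (Sum.inl i))
        (fun i => enc s a (Sum.inr i))) = enc s a (i j) := by
      intro a j
      rw [hi j]
      cases i j <;> simp
    match l, R with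
    | 0, R => exact Empty.elim R
    | 1, R => exact Empty.elim R
    | 2, R =>
      convert SL.le_var s (i 0) (i 1) using 3 with a
      simp only [BoundedFormula.Realize, hr]
      exact Iff.rfl
    | 3, R => exact Empty.elim R
    | 4, R =>
      convert SL.C_var s (i 0) (i 1) (i 2) (i 3) using 3 with a
      simp only [BoundedFormula.Realize, hr]
      exact Iff.rfl
    | (_ + 5), R => exact Empty.elim R
  | imp φ ψ h1 h2 =>
    intro s
    exact SL.imp (h1 s) (h2 s)
  | @all n φ ih =>
    intro s
    let e : β ⊕ Fin (n + 1) → Option (β ⊕ Fin n) :=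
      Sum.elim (fun i => some (Sum.inl i)) (Fin.lastCases none (fun j => some (Sum.inr j)))
    let s' : SignType → β ⊕ Fin (n + 1) → SignType := fun σ i => (e i).elim σ s
    have h := SL.and (SL.all e (ih (s' (-1)))) (SL.and (SL.all e (ih (s' 0)))
      (SL.all e (ih (s' 1))))
    have key : ∀ (σ : SignType) (a : β ⊕ Fin n → ℝ) (t : ℝ),
        φ.Realize (fun i => enc (s' σ) (fun i => (e i).elim t a) (Sum.inl i))
          (fun i => enc (s' σ) (fun i => (e i).elim t a) (Sum.inr i)) ↔
        φ.Realize (fun i => enc s a (Sum.inl i))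
          (Fin.snoc (fun i => enc s a (Sum.inr i)) (σ * Real.exp t)) := by
      intro σ a t
      have : (fun i => enc (s' σ) (fun i => (e i).elim t a) (Sum.inr i)) =
          (Fin.snoc (fun i => enc s a (Sum.inr i)) (σ * Real.exp t) : Fin (n + 1) → ℝ) := by
        funext i
        refine Fin.lastCases ?_ (fun j => ?_) i
        · simp [enc, s', e]
        · simp [enc, s', e]
      rw [this]
      rfl
    convert h using 3 with a
    simp only [Set.mem_ofPred_eq, key, BoundedFormula.realize_all]
    constructor
    · intro h
      exact ⟨fun t => h _, fun t => h _, fun t => h _⟩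
    · rintro ⟨h1, h2, h3⟩ x
      obtain ⟨σ, t, rfl⟩ := exists_sign_exp x
      cases σ
      · exact h2 t
      · exact h1 t
      · exact h3 t

end semilinear

section affine

lemma Lin.exists_coeff {V : Type*} [Fintype V] {f : (V → ℝ) → ℝ} (hf : f ∈ Lin V) :
    ∃ q : V → ℚ, ∀ v, f v = ∑ i, (q i : ℝ) * v i := by
  obtain ⟨q, hq⟩ := (Submodule.mem_span_range_iff_exists_fun ℚ).1 hf
  refine ⟨q, fun v => ?_⟩
  rw [← hq]
  simp [Finset.sum_apply, Rat.smul_def]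

lemma Lin.plug {W V : Type*} (par : W → ℝ) {f : ((W ⊕ V) ⊕ Fin 0 → ℝ) → ℝ}
    (hf : f ∈ Lin ((W ⊕ V) ⊕ Fin 0)) :
    ∃ g ∈ Lin V, ∃ c : ℝ, ∀ v, f (Sum.elim (Sum.elim par v) Fin.elim0) = g v + c := by
  induction hf using Submodule.span_induction with
  | mem f hf =>
    obtain ⟨i, rfl⟩ := hf
    rcases i with (i | i) | i
    · exact ⟨0, Submodule.zero_mem _, par i, fun v => by simp⟩
    · exact ⟨fun v => v i, Lin.coord i, 0, fun v => by simp⟩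
    · exact i.elim0
  | zero => exact ⟨0, Submodule.zero_mem _, 0, fun v => by simp⟩
  | add f g _ _ h1 h2 =>
    obtain ⟨f0, h1, c, h1'⟩ := h1
    obtain ⟨g0, h2, d, h2'⟩ := h2
    exact ⟨f0 + g0, Submodule.add_mem _ h1 h2, c + d, fun v => by
      simp only [Pi.add_apply, h1', h2']; ring⟩
  | smul q f _ h1 =>
    obtain ⟨f0, h1, c, h1'⟩ := h1
    exact ⟨q • f0, Submodule.smul_mem _ _ h1, q * c, fun v => by
      simp only [Pi.smul_apply, h1', Rat.smul_def]; ring⟩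

lemma definable_affine {V : Type} [Fintype V] {D : Set (V → ℝ)}
    (hD : (Set.univ : Set ℝ).Definable LC D) (s : V → SignType) :
    ∃ (I : Type) (_ : Finite I) (q : I → V → ℚ) (c : I → ℝ), ∀ v w : V → ℝ,
      (∀ i, SS (∑ j, (q i j : ℝ) * v j + c i) (∑ j, (q i j : ℝ) * w j + c i)) →
      enc s v ∈ D → enc s w ∈ D := by
  obtain ⟨φ, rfl⟩ := Set.definable_iff_exists_formula_sum.1 hD
  choose σ τ hτ using fun x : (Set.univ : Set ℝ) => exists_sign_exp x.1
  obtain ⟨F, hF, hF'⟩ := SL.formula φ (Sum.elim (Sum.elim σ s) Fin.elim0)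
  choose g hg c hc using fun f : F => Lin.plug τ (hF f.1 f.2)
  choose q hq using fun f : F => Lin.exists_coeff (hg f)
  have key : ∀ v : V → ℝ, enc s v ∈ {v : V → ℝ | φ.Realize (Sum.elim (↑) v)} ↔
      (Sum.elim (Sum.elim τ v) Fin.elim0 : _ → ℝ) ∈
        {a | BoundedFormula.Realize φ
          (fun i => enc (Sum.elim (Sum.elim σ s) Fin.elim0) a (Sum.inl i))
          (fun i => enc (Sum.elim (Sum.elim σ s) Fin.elim0) a (Sum.inr i))} := by
    intro v
    simp only [Set.mem_ofPred_eq, Formula.Realize]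
    have h1 : (fun i => enc (Sum.elim (Sum.elim σ s) Fin.elim0)
        (Sum.elim (Sum.elim τ v) Fin.elim0) (Sum.inl i)) = Sum.elim (↑) (enc s v) := by
      funext i
      rcases i with i | i
      · simp [enc, hτ i]
      · simp [enc]
    rw [h1]
    exact iff_of_eq (congrArg _ (Subsingleton.elim _ _))
  refine ⟨F, inferInstance, q, c, fun v w h hv => ?_⟩
  rw [key] at hv ⊢
  refine hF' _ _ (fun f hf => ?_) hv
  have := h ⟨f, hf⟩
  rwa [← hq, ← hq, ← hc, ← hc] at this

lemma omin_of_points (P : Finset ℝ) (S : Set ℝ)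
    (h : ∀ x y, (∀ p ∈ P, SS (x - p) (y - p)) → x ∈ S → y ∈ S) :
    ∃ F : Finset (Set ℝ), S = ⋃₀ (F : Set (Set ℝ)) ∧
      ∀ t ∈ F, (∃ a : ℝ, t = {a}) ∨ (∃ a b : ℝ, t = Set.Ioo a b) ∨
        (∃ a : ℝ, t = Set.Ioi a) ∨ (∃ a : ℝ, t = Set.Iio a) ∨ t = Set.univ := by
  classical
  let g : Finset ℝ × Finset ℝ → Set ℝ := fun LR =>
    {y | P.filter (· < y) = LR.1 ∧ P.filter (y < ·) = LR.2}
  let cell : ℝ → Set ℝ := fun x => g (P.filter (· < x), P.filter (x < ·))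
  have hcell : ∀ x y, y ∈ cell x ↔ ∀ p ∈ P, (p < y ↔ p < x) ∧ (y < p ↔ x < p) := by
    intro x y
    simp only [cell, g, Set.mem_ofPred_eq, Finset.ext_iff, Finset.mem_filter]
    constructor
    · rintro ⟨h1, h2⟩ p hp
      have := h1 p; have := h2 p
      tauto
    · intro h1
      constructor <;> intro p <;> have := h1 p <;> tauto
  refine ⟨((P.powerset ×ˢ P.powerset).image g).filter (fun t => ∃ x ∈ S, t = cell x), ?_, ?_⟩
  · ext y
    simp only [Set.mem_sUnion, Finset.mem_coe, Finset.mem_filter]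
    constructor
    · intro hy
      refine ⟨cell y, ⟨Finset.mem_image.2 ⟨(P.filter (· < y), P.filter (y < ·)), ?_, rfl⟩,
        y, hy, rfl⟩, ?_⟩
      · simp [Finset.mem_product]
      · exact ⟨rfl, rfl⟩
    · rintro ⟨t, ⟨-, x, hx, rfl⟩, hy⟩
      refine h x y (fun p hp => ?_) hx
      have := (hcell x y).1 hy p hp
      unfold SS
      rw [sub_neg, sub_neg, sub_pos, sub_pos]
      exact ⟨this.2.symm, this.1.symm⟩
  · intro t ht
    obtain ⟨-, x, -, rfl⟩ := Finset.mem_filter.1 ht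
    by_cases hx : x ∈ P
    · left
      refine ⟨x, ?_⟩
      ext y
      rw [hcell, Set.mem_singleton_iff]
      constructor
      · intro h1
        have := h1 x hx
        simp only [lt_irrefl, iff_false, not_lt] at this
        exact le_antisymm this.1 this.2
      · rintro rfl p hp
        exact ⟨Iff.rfl, Iff.rfl⟩
    right
    have hne : ∀ p ∈ P, p < x ∨ x < p := fun p hp => lt_or_gt_of_ne (fun e => hx (e ▸ hp))
    have hcell' : ∀ y, y ∈ cell x ↔ (∀ p ∈ P.filter (· < x), p < y) ∧
        (∀ p ∈ P.filter (x < ·), y < p) := by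
      intro y
      rw [hcell]
      simp only [Finset.mem_filter, and_imp]
      constructor
      · intro h1
        exact ⟨fun p hp h2 => (h1 p hp).1.2 h2, fun p hp h2 => (h1 p hp).2.2 h2⟩
      · rintro ⟨h1, h2⟩ p hp
        rcases hne p hp with h3 | h3
        · have := h1 p hp h3
          constructor <;> constructor <;> intro h4 <;> linarith
        · have := h2 p hp h3
          constructor <;> constructor <;> intro h4 <;> linarith
    by_cases hL : (P.filter (· < x)).Nonempty <;> by_cases hR : (P.filter (x < ·)).Nonempty
    · left
      refine ⟨(P.filter (· < x)).max' hL, (P.filter (x < ·)).min' hR, ?_⟩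
      ext y
      rw [hcell', Set.mem_Ioo, Finset.max'_lt_iff, Finset.lt_min'_iff]
    · right; left
      refine ⟨(P.filter (· < x)).max' hL, ?_⟩
      ext y
      rw [Finset.not_nonempty_iff_eq_empty] at hR
      rw [hcell', Set.mem_Ioi, Finset.max'_lt_iff, hR]
      simp
    · right; right; left
      refine ⟨(P.filter (x < ·)).min' hR, ?_⟩
      ext y
      rw [Finset.not_nonempty_iff_eq_empty] at hL
      rw [hcell', Set.mem_Iio, Finset.lt_min'_iff, hL]
      simp
    · right; right; right
      ext y
      rw [Finset.not_nonempty_iff_eq_empty] at hL hR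
      rw [hcell', hL, hR]
      simp

lemma SS_exp (σ : SignType) (a b r : ℝ)
    (hσ : σ ≠ 0) (h : SS (σ * Real.exp a - σ * Real.exp r) (σ * Real.exp b - σ * Real.exp r)) :
    SS (a - r) (b - r) := by
  have h1 := h.1
  have h2 := h.2
  unfold SS
  cases σ
  · exact absurd rfl hσ
  · simp at h1 h2
    simp only [sub_neg, sub_pos]
    exact ⟨by simpa using h2, by simpa using h1⟩
  · simp at h1 h2
    simp only [sub_neg, sub_pos]
    exact ⟨by simpa using h1, by simpa using h2⟩

theorem omin : IsOMinimal LC ℝ := by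
  classical
  refine ⟨inferInstance, inferInstance, inferInstance, inferInstance,
    def_lt (by fun_prop) (by fun_prop), ?_⟩
  intro S hS
  choose I hI q c h using fun σ : SignType => definable_affine hS (fun _ => σ)
  have hfin : (Set.range fun x : (σ : SignType) × I σ =>
      (x.1 : ℝ) * Real.exp (-(c x.1 x.2) / (q x.1 x.2 0))).Finite := Set.finite_range _
  refine omin_of_points (insert 0 hfin.toFinset) S (fun x y hxy hx => ?_)
  obtain ⟨σ, a, rfl⟩ := exists_sign_exp x
  obtain ⟨τ, b, rfl⟩ := exists_sign_exp y
  have h0 := hxy 0 (Finset.mem_insert_self _ _)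
  have hστ : σ = τ := by
    have pa := Real.exp_pos a
    have pb := Real.exp_pos b
    have h1 := h0.1
    have h2 := h0.2
    cases σ <;> cases τ <;> simp [pa, pb, pa.le, pb.le, not_lt.2] at h1 h2 ⊢
  subst hστ
  by_cases hσ : σ = 0
  · subst hσ; simpa using hx
  have := h σ (fun _ => a) (fun _ => b) (fun i => ?_) hx
  · exact this
  · simp only [Finset.univ_unique, Fin.default_eq_zero, Finset.sum_singleton, Fin.isValue]
    by_cases hq : q σ i 0 = 0
    · simp [hq, SS]
    · have hq' : (q σ i 0 : ℝ) ≠ 0 := by exact_mod_cast hq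
      have h3 := hxy ((σ : ℝ) * Real.exp (-(c σ i) / (q σ i 0)))
        (Finset.mem_insert_of_mem (hfin.mem_toFinset.2 ⟨⟨σ, i⟩, rfl⟩))
      have h4 := (SS_exp σ a b _ hσ h3).mul (q σ i 0)
      have key : ∀ x : ℝ, (q σ i 0 : ℝ) * (x - -(c σ i) / (q σ i 0)) = q σ i 0 * x + c σ i := by
        intro x; field_simp; ring
      rwa [key, key] at h4

lemma fiber_affine {m : ℕ} {D : Set (Fin m ⊕ Fin 2 → ℝ)}
    (hD : (Set.univ : Set ℝ).Definable LC D) :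
    ∃ (I : Type) (_ : Finite I) (α β : I → ℚ), ∀ u : Fin m → ℝ, ∃ c : I → ℝ, ∀ a b a' b' : ℝ,
      (∀ i, SS (α i * a + β i * b + c i) (α i * a' + β i * b' + c i)) →
      ![Real.exp b, -Real.exp a] ∈ famFiber D u → ![Real.exp b', -Real.exp a'] ∈ famFiber D u := by
  choose I hI q c h using fun s : Fin m → SignType => definable_affine hD (Sum.elim s ![1, -1])
  refine ⟨(s : Fin m → SignType) × I s, inferInstance, fun x => q x.1 x.2 (Sum.inr 1),
    fun x => q x.1 x.2 (Sum.inr 0), fun u => ?_⟩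
  choose s w hw using fun j => exists_sign_exp (u j)
  refine ⟨fun x => ∑ j, (q x.1 x.2 (Sum.inl j) : ℝ) * w j + c x.1 x.2, ?_⟩
  intro a b a' b' hss hm
  have key : ∀ a b : ℝ, ![Real.exp b, -Real.exp a] ∈ famFiber D u ↔
      enc (Sum.elim s ![1, -1]) (Sum.elim w ![b, a]) ∈ D := by
    intro a b
    have : Sum.elim u ![Real.exp b, -Real.exp a] =
        enc (Sum.elim s ![1, -1]) (Sum.elim w ![b, a]) := by
      funext i
      rcases i with i | i
      · simp [enc, hw i]
      · fin_cases i <;> simp [enc]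
    rw [← this]
    rfl
  rw [key] at hm ⊢
  refine h s _ _ (fun i => ?_) hm
  have := hss ⟨s, i⟩
  simp only [Fintype.sum_sum_type, Sum.elim_inl, Sum.elim_inr, Fin.sum_univ_two,
    Matrix.cons_val_zero, Matrix.cons_val_one]
  convert this using 1 <;> ring

end affine

section automorphism

/-- Scaling of the negative half line. -/
noncomputable def scFun (l : ℝ) (x : ℝ) : ℝ := if x < 0 then l * x else x

lemma scFun_neg {l x : ℝ} (h : x < 0) : scFun l x = l * x := by simp [scFun, h]
lemma scFun_nonneg {l x : ℝ} (h : 0 ≤ x) : scFun l x = x := by simp [scFun, not_lt.2 h]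

lemma scFun_neg_iff {l x : ℝ} (hl : 0 < l) : scFun l x < 0 ↔ x < 0 := by
  by_cases h : x < 0
  · rw [scFun_neg h]; simp only [h, iff_true]; exact mul_neg_of_pos_of_neg hl h
  · rw [scFun_nonneg (not_lt.1 h)]

lemma scFun_le_iff {l x y : ℝ} (hl : 0 < l) : scFun l x ≤ scFun l y ↔ x ≤ y := by
  rcases lt_or_ge x 0 with hx | hx <;> rcases lt_or_ge y 0 with hy | hy
  · rw [scFun_neg hx, scFun_neg hy]; exact mul_le_mul_iff_right₀ hl
  · have := (scFun_neg_iff hl).2 hx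
    rw [scFun_nonneg hy]
    constructor <;> intro _ <;> linarith
  · have := (scFun_neg_iff hl).2 hy
    rw [scFun_nonneg hx]
    constructor <;> intro _ <;> linarith
  · rw [scFun_nonneg hx, scFun_nonneg hy]

lemma scFun_inv {l x : ℝ} (hl : 0 < l) : scFun l⁻¹ (scFun l x) = x := by
  by_cases h : x < 0
  · rw [scFun_neg ((scFun_neg_iff hl).2 h), scFun_neg h]; field_simp
  · rw [scFun_nonneg (not_lt.1 h), scFun_nonneg (not_lt.1 h)]

lemma scFun_C {l : ℝ} (hl : 0 < l) (x y z w : ℝ) :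
    CRel (scFun l x) (scFun l y) (scFun l z) (scFun l w) ↔ CRel x y z w := by
  have lt_iff : ∀ a b, scFun l a < scFun l b ↔ a < b := by
    intro a b
    rw [← not_le, ← not_le, scFun_le_iff hl]
  have h0 : scFun l 0 = 0 := scFun_nonneg le_rfl
  unfold CRel
  rw [lt_iff, lt_iff, scFun_neg_iff hl]
  have h1 : 0 < scFun l z ↔ 0 < z := by
    conv_lhs => rw [← h0]
    exact lt_iff 0 z
  rw [h1]
  refine and_congr_right fun hxy => and_congr_right fun hy => and_congr_right fun hz =>
    and_congr_right fun hw => ?_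
  rw [scFun_neg hy, scFun_neg (hxy.trans hy), scFun_nonneg hz.le, scFun_nonneg (hz.trans hw).le]
  rw [mul_assoc, mul_assoc]
  exact mul_right_inj' hl.ne'

noncomputable def sc (l : ℝ) (hl : 0 < l) : ℝ ≃[LC] ℝ where
  toFun := scFun l
  invFun := scFun l⁻¹
  left_inv x := scFun_inv hl
  right_inv x := by
    have := scFun_inv (l := l⁻¹) (x := x) (inv_pos.2 hl)
    rwa [inv_inv] at this
  map_fun' {n} f _ := Empty.elim f
  map_rel' {n} R v := by
    match n, R with
    | 0, R => exact Empty.elim R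
    | 1, R => exact Empty.elim R
    | 2, R => exact scFun_le_iff hl
    | 3, R => exact Empty.elim R
    | 4, R => exact scFun_C hl _ _ _ _
    | (_ + 5), R => exact Empty.elim R

lemma invariant {α : Type*} {D : Set (α → ℝ)} (hD : (∅ : Set ℝ).Definable LC D) {l : ℝ}
    (hl : 0 < l) (v : α → ℝ) : scFun l ∘ v ∈ D ↔ v ∈ D := by
  obtain ⟨φ, rfl⟩ := Set.empty_definable_iff.1 hD
  exact StrongHomClass.realize_formula (sc l hl) φ

lemma HP_sc {k : ℚ} {q l : ℝ} (hl : 0 < l) (v : Fin 2 → ℝ) :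
    scFun l ∘ v ∈ HP k (q + Real.log l) ↔ v ∈ HP k q := by
  simp only [HP, Set.mem_ofPred_eq, Function.comp]
  rw [scFun_neg_iff hl]
  refine and_congr_right fun hy => ?_
  have h0 : 0 < scFun l (v 0) ↔ 0 < v 0 := by
    have h0 : scFun l 0 = 0 := scFun_nonneg le_rfl
    rw [← not_le, ← not_le]
    conv_lhs => rw [← h0, scFun_le_iff hl]
  rw [h0]
  refine and_congr_right fun hx => ?_
  rw [scFun_neg hy, scFun_nonneg hx.le, ← mul_neg, Real.log_mul hl.ne' (by linarith)]
  constructor <;> intro h <;> linarith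

lemma fiber_sc {m : ℕ} {D : Set (Fin m ⊕ Fin 2 → ℝ)} (hD : (∅ : Set ℝ).Definable LC D)
    {l : ℝ} (hl : 0 < l) (u : Fin m → ℝ) (v : Fin 2 → ℝ) :
    scFun l ∘ v ∈ famFiber D (scFun l ∘ u) ↔ v ∈ famFiber D u := by
  have := invariant hD hl (Sum.elim u v)
  rwa [Sum.comp_elim] at this

lemma exists_sc {α : Type*} {l : ℝ} (hl : 0 < l) (v : α → ℝ) : ∃ v0, v = scFun l ∘ v0 :=
  ⟨scFun l⁻¹ ∘ v, by
    funext i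
    have := scFun_inv (l := l⁻¹) (x := v i) (inv_pos.2 hl)
    rw [inv_inv] at this
    exact this.symm⟩

lemma exists_params {X : Set (Fin 2 → ℝ)} (hX : (Set.univ : Set ℝ).Definable LC X) :
    ∃ (m : ℕ) (D : Set (Fin m ⊕ Fin 2 → ℝ)) (u : Fin m → ℝ),
      (∅ : Set ℝ).Definable LC D ∧ X = famFiber D u := by
  obtain ⟨A0, -, hA⟩ := Set.definable_iff_finitely_definable.1 hX
  obtain ⟨φ, rfl⟩ := Set.definable_iff_exists_formula_sum.1 hA
  let e := A0.equivFin
  refine ⟨A0.card, {w | (φ.relabel (Sum.map e id) : LC.Formula (Fin A0.card ⊕ Fin 2)).Realize w},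
    fun i => (e.symm i : ℝ), ?_, ?_⟩
  · exact Set.empty_definable_iff.2 ⟨_, rfl⟩
  · ext v
    simp only [famFiber, Set.mem_ofPred_eq, Formula.realize_relabel]
    apply iff_of_eq
    congr 1
    funext i
    rcases i with i | i
    · simp
    · simp

end automorphism

section main

lemma type_inter {I : Type*} [Finite I] {p : Set (Set (Fin 2 → ℝ))} (hp : IsTypeOn LC 2 p)
    (X : I → Set (Fin 2 → ℝ)) (hX : ∀ i, X i ∈ p) (Y : Set (Fin 2 → ℝ)) (hY : Y ∈ p) :
    ∃ Z ∈ p, Z ⊆ Y ∧ ∀ i, Z ⊆ X i := by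
  classical
  cases nonempty_fintype I
  have : ∀ s : Finset I, ∃ Z ∈ p, Z ⊆ Y ∧ ∀ i ∈ s, Z ⊆ X i := by
    intro s
    induction s using Finset.induction_on with
    | empty => exact ⟨Y, hY, subset_rfl, by simp⟩
    | insert a s ha ih =>
      obtain ⟨Z, hZ, h1, h2⟩ := ih
      refine ⟨Z ∩ X a, hp.2.2.1 _ hZ _ (hX a), Set.inter_subset_left.trans h1, ?_⟩
      intro i hi
      rcases Finset.mem_insert.1 hi with rfl | hi
      · exact Set.inter_subset_right
      · exact Set.inter_subset_left.trans (h2 i hi)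
  obtain ⟨Z, hZ, h1, h2⟩ := this Finset.univ
  exact ⟨Z, hZ, h1, fun i => h2 i (Finset.mem_univ i)⟩

lemma type_nonempty {p : Set (Set (Fin 2 → ℝ))} (hp : IsTypeOn LC 2 p) {Z : Set (Fin 2 → ℝ)}
    (hZ : Z ∈ p) : Z.Nonempty := by
  rw [Set.nonempty_iff_ne_empty]
  rintro rfl
  exact hp.2.1 hZ

def strip (t : ℝ) : Set (Fin 2 → ℝ) := {v | v 1 < 0 ∧ t < v 0}

lemma mem_HP {k : ℚ} {q a b : ℝ} : ![Real.exp b, -Real.exp a] ∈ HP k q ↔ q < a - k * b := by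
  simp [HP, Real.exp_pos]

lemma main_contra {S' p : Set (Set (Fin 2 → ℝ))}
    (hdef : IsDefFamily LC (Set.univ : Set ℝ) 2 S') (hp : IsTypeOn LC 2 p) (hSp : S' ⊆ p)
    (hgen : ∀ Y ∈ p, ∃ Z ∈ S', Z ⊆ Y) (hstrip : ∀ t, strip t ∈ p)
    (hshift : ∀ (k : ℚ) (q q' : ℝ), HP k q ∈ p → HP k q' ∈ p) : False := by
  classical
  obtain ⟨m, Ω, D, -, hD, rfl⟩ := hdef
  obtain ⟨I, hI, α, β, hfib⟩ := fiber_affine hD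
  cases nonempty_fintype I
  have hlow : ∀ k q, HP k 0 ∈ p → HP k q ∈ p := fun k q h => hshift k 0 q h
  have hhigh : ∀ k q, HP k 0 ∉ p → (HP k q)ᶜ ∈ p := by
    intro k q h
    rcases hp.2.2.2.2 (HP k q) (def_HP k q) with h1 | h1
    · exact absurd (hshift k q 0 h1) h
    · exact h1
  -- points of members of `p` in logarithmic coordinates
  have hpt : ∀ Z ∈ p, ∃ a b : ℝ, 0 < b ∧ ![Real.exp b, -Real.exp a] ∈ Z := by
    intro Z hZ
    obtain ⟨v, hv, hv1, hv2⟩ := type_nonempty hp (hp.2.2.1 _ hZ _ (hstrip 1))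
    refine ⟨Real.log (- v 1), Real.log (v 0), Real.log_pos hv2, ?_⟩
    rw [Real.exp_log (by linarith), Real.exp_log (by linarith)]
    convert hv using 1
    funext i
    fin_cases i <;> simp
  let K : Finset ℚ := (Finset.univ.filter (fun i => α i ≠ 0)).image (fun i => -(β i) / α i)
  obtain ⟨k, hk1, hk2⟩ := Order.exists_between_finsets (K.filter fun x => HP x 0 ∈ p)
    (K.filter fun x => HP x 0 ∉ p) (by
      intro x hx y hy
      have hx := (Finset.mem_filter.1 hx).2
      have hy := (Finset.mem_filter.1 hy).2
      by_contra hxy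
      obtain ⟨a, b, hb, h1, h2⟩ := hpt _ (hp.2.2.1 _ hx _ (hhigh y 0 hy))
      rw [Set.mem_compl_iff, mem_HP] at h2
      rw [mem_HP] at h1
      have h3 : (y : ℝ) ≤ x := by exact_mod_cast not_lt.1 hxy
      nlinarith)
  have hlo : ∀ i, α i ≠ 0 → HP (-(β i) / α i) 0 ∈ p → -(β i) / α i < k := fun i hi h =>
    hk1 _ (Finset.mem_filter.2 ⟨Finset.mem_image.2 ⟨i, by simpa using hi, rfl⟩, h⟩)
  have hhi : ∀ i, α i ≠ 0 → HP (-(β i) / α i) 0 ∉ p → k < -(β i) / α i := fun i hi h =>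
    hk2 _ (Finset.mem_filter.2 ⟨Finset.mem_image.2 ⟨i, by simpa using hi, rfl⟩, h⟩)
  -- the decisive member
  obtain ⟨ε, Z0, hZ0, hε⟩ : ∃ ε : ℝ, ∃ Z0 ∈ famFiber D '' Ω, ∀ b : ℝ,
      ![Real.exp b, -Real.exp (k * b + ε)] ∉ Z0 := by
    by_cases hk : HP k 0 ∈ p
    · obtain ⟨Z0, hZ0, h⟩ := hgen _ hk
      refine ⟨-1, Z0, hZ0, fun b hb => ?_⟩
      have := mem_HP.1 (h hb)
      linarith
    · obtain ⟨Z0, hZ0, h⟩ := hgen _ (hhigh k 0 hk)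
      refine ⟨1, Z0, hZ0, fun b hb => ?_⟩
      refine h hb (mem_HP.2 ?_)
      linarith
  have hZp := hSp hZ0
  obtain ⟨u, -, rfl⟩ := hZ0
  obtain ⟨c, hc⟩ := hfib u
  have claim1 : ∀ i, ∀ᶠ b : ℝ in Filter.atTop,
      (0 < (α i : ℝ) * k + β i → 0 < α i * (k * b + ε) + β i * b + c i) ∧
      ((α i : ℝ) * k + β i < 0 → α i * (k * b + ε) + β i * b + c i < 0) := by
    intro i
    have key : ∀ b : ℝ, α i * (k * b + ε) + β i * b + c i
        = ((α i : ℝ) * k + β i) * b + (α i * ε + c i) := fun b => by ring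
    simp only [key]
    rcases lt_trichotomy ((α i : ℝ) * k + β i) 0 with h | h | h
    · have := Filter.tendsto_atBot_add_const_right _ (α i * ε + c i)
        ((Filter.tendsto_id (α := ℝ) (x := Filter.atTop)).const_mul_atTop_of_neg h)
      filter_upwards [this.eventually_lt_atBot 0] with b hb
      exact ⟨fun h' => absurd h (not_lt.2 h'.le), fun _ => hb⟩
    · exact Filter.Eventually.of_forall fun b => ⟨fun h' => absurd h h'.ne', fun h' => absurd h h'.ne⟩
    · have := Filter.tendsto_atTop_add_const_right _ (α i * ε + c i)
        ((Filter.tendsto_id (α := ℝ) (x := Filter.atTop)).const_mul_atTop h)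
      filter_upwards [this.eventually_gt_atTop 0] with b hb
      exact ⟨fun _ => hb, fun h' => absurd h (not_lt.2 h'.le)⟩
  obtain ⟨b1, hb1⟩ := (Filter.eventually_all.2 claim1).exists
  have claim2 : ∀ i, ∃ X ∈ p, ∀ a b : ℝ, ![Real.exp b, -Real.exp a] ∈ X →
      (0 < (α i : ℝ) * k + β i → 0 < α i * a + β i * b + c i) ∧
      ((α i : ℝ) * k + β i < 0 → α i * a + β i * b + c i < 0) := by
    intro i
    by_cases hα : α i = 0
    · refine ⟨strip (Real.exp (|c i| / |(β i : ℝ)|)), hstrip _, fun a b hab => ?_⟩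
      have hb : |c i| / |(β i : ℝ)| < b := by
        simpa [strip] using hab.2
      simp only [hα, Rat.cast_zero, zero_mul, zero_add]
      constructor
      · intro h
        rw [abs_of_pos h, div_lt_iff₀ h] at hb
        linarith [neg_abs_le (c i)]
      · intro h
        rw [abs_of_neg h, div_lt_iff₀ (by linarith)] at hb
        linarith [le_abs_self (c i)]
    · have hα' : (α i : ℝ) ≠ 0 := by exact_mod_cast hα
      have hγ : (α i : ℝ) * k + β i = α i * (k - ((-(β i) / α i : ℚ) : ℝ)) := by
        push_cast; field_simp; ring
      have hγ' : ∀ a b : ℝ, (α i : ℝ) * a + β i * b + c i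
          = α i * ((a - ((-(β i) / α i : ℚ) : ℝ) * b) + c i / α i) := by
        intro a b; push_cast; field_simp; ring
      have e1 := neg_abs_le (c i / α i)
      have e2 := le_abs_self (c i / α i)
      by_cases hl : HP (-(β i) / α i) 0 ∈ p
      · refine ⟨_, hlow _ (|c i / α i|) hl, fun a b hab => ?_⟩
        rw [mem_HP] at hab
        have h1 : ((-(β i) / α i : ℚ) : ℝ) < k := by exact_mod_cast hlo i hα hl
        rw [hγ, hγ']
        have h2 : 0 < (k : ℝ) - ((-(β i) / α i : ℚ) : ℝ) := by linarith
        have h3 : 0 < (a - ((-(β i) / α i : ℚ) : ℝ) * b) + c i / α i := by linarith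
        constructor
        · intro h
          exact mul_pos ((pos_iff_pos_of_mul_pos h).2 h2) h3
        · intro h
          exact mul_neg_of_neg_of_pos (neg_of_mul_neg_left h h2.le) h3
      · refine ⟨_, hhigh _ (-(|c i / α i| + 1)) hl, fun a b hab => ?_⟩
        rw [Set.mem_compl_iff, mem_HP, not_lt] at hab
        have h1 : (k : ℝ) < ((-(β i) / α i : ℚ) : ℝ) := by exact_mod_cast hhi i hα hl
        rw [hγ, hγ']
        have h2 : (k : ℝ) - ((-(β i) / α i : ℚ) : ℝ) < 0 := by linarith
        have h3 : (a - ((-(β i) / α i : ℚ) : ℝ) * b) + c i / α i < 0 := by linarith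
        constructor
        · intro h
          have : (α i : ℝ) < 0 := by
            by_contra h4
            nlinarith [mul_nonneg (not_lt.1 h4) (neg_nonneg.2 h2.le)]
          exact mul_pos_of_neg_of_neg this h3
        · intro h
          have : 0 < (α i : ℝ) := by
            by_contra h4
            nlinarith [mul_nonneg (neg_nonneg.2 (not_lt.1 h4)) (neg_nonneg.2 h2.le)]
          exact mul_neg_of_pos_of_neg this h3
  choose X hXp hX using claim2
  obtain ⟨Z, hZ, hZ1, hZ2⟩ := type_inter hp X hXp _ hZp
  obtain ⟨a, b, -, hab⟩ := hpt Z hZ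
  refine hε b1 (hc a b _ _ (fun i => ?_) (hZ1 hab))
  obtain ⟨h1, h2⟩ := hX i a b (hZ2 i hab)
  obtain ⟨h3, h4⟩ := hb1 i
  rcases lt_trichotomy ((α i : ℝ) * k + β i) 0 with h | h | h
  · have := h2 h; have := h4 h
    constructor <;> constructor <;> intro _ <;> linarith
  · have hα : α i = 0 := by
      by_contra hα
      have h' : α i * k + β i = 0 := by exact_mod_cast h
      have : k = -(β i) / α i := by field_simp; linarith
      by_cases hl : HP (-(β i) / α i) 0 ∈ p
      · exact absurd this (hlo i hα hl).ne'
      · exact absurd this (hhi i hα hl).ne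
    have hβ : (β i : ℝ) = 0 := by simpa [hα] using h
    simp [hα, hβ, SS]
  · have := h1 h; have := h3 h
    constructor <;> constructor <;> intro _ <;> linarith

lemma shift_of_log {p : Set (Set (Fin 2 → ℝ))}
    (h : ∀ (k : ℚ) (q l : ℝ), 0 < l → HP k q ∈ p → HP k (q + Real.log l) ∈ p)
    (k : ℚ) (q q' : ℝ) (hq : HP k q ∈ p) : HP k q' ∈ p := by
  have := h k q (Real.exp (q' - q)) (Real.exp_pos _) hq
  rwa [Real.log_exp, add_sub_cancel] at this

end main

end S19

/-- Appendix B, Johnson: the structure `(ℝ,≤,C)` is o-minimal; the family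
`S = {{(x,y) : y < 0 ∧ x > t} : t ∈ ℝ}` is a `∅`-definable downward directed family of subsets
of `ℝ²`; and no definable downward directed family finer than `S` that generates a complete
`2`-type `p` is `∅`-definable, nor is `p`. -/
theorem statement19 :
    IsOMinimal LC ℝ ∧
    (IsDefFamily LC (∅ : Set ℝ) 2
        {S : Set (Fin 2 → ℝ) | ∃ t : ℝ, S = {v | v 1 < 0 ∧ t < v 0}} ∧
      DirectedFam {S : Set (Fin 2 → ℝ) | ∃ t : ℝ, S = {v | v 1 < 0 ∧ t < v 0}}) ∧
    (∀ (S' : Set (Set (Fin 2 → ℝ))) (p : Set (Set (Fin 2 → ℝ))),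
      IsDefFamily LC (Set.univ : Set ℝ) 2 S' → DirectedFam S' →
      FinerThan S' {S : Set (Fin 2 → ℝ) | ∃ t : ℝ, S = {v | v 1 < 0 ∧ t < v 0}} →
      IsCompleteFam LC 2 S' →
      IsTypeOn LC 2 p → S' ⊆ p → (∀ Y ∈ p, ∃ Z ∈ S', Z ⊆ Y) →
      ¬ IsDefFamily LC (∅ : Set ℝ) 2 S' ∧ ¬ IsDefTypeOver LC (∅ : Set ℝ) 2 p) := by
  refine ⟨S19.omin, ⟨?_, ?_, ?_⟩, ?_⟩
  · refine ⟨1, Set.univ, {w | w (Sum.inr 1) < 0 ∧ w (Sum.inl 0) < w (Sum.inr 0)},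
      Set.definable_univ, S19.def_and (S19.def_neg (by fun_prop))
        (S19.def_lt (by fun_prop) (by fun_prop)), ?_⟩
    ext X
    constructor
    · rintro ⟨t, rfl⟩
      exact ⟨fun _ => t, Set.mem_univ _, rfl⟩
    · rintro ⟨u, -, rfl⟩
      exact ⟨u 0, rfl⟩
  · rintro ⟨t, ht⟩
    have : (![t + 1, -1] : Fin 2 → ℝ) ∈ (∅ : Set (Fin 2 → ℝ)) := by
      rw [ht]
      simp
    exact this
  · rintro X ⟨t, rfl⟩ Y ⟨t', rfl⟩
    refine ⟨_, ⟨max t t', rfl⟩, ?_⟩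
    rintro v ⟨h1, h2⟩
    have := max_lt_iff.1 h2
    exact ⟨⟨h1, this.1⟩, h1, this.2⟩
  · intro S' p hdef _ hfin _ hp hSp hgen
    have hstrip : ∀ t, S19.strip t ∈ p := by
      intro t
      obtain ⟨Y, hY, hYs⟩ := hfin _ ⟨t, rfl⟩
      exact hp.2.2.2.1 Y (hSp hY) _ (S19.def_and (S19.def_lt (by fun_prop) (S19.def_const 0))
        (S19.def_lt (S19.def_const t) (by fun_prop))) hYs
    constructor
    · rintro ⟨m, Ω, D, hΩ, hD, hS⟩
      refine S19.main_contra hdef hp hSp hgen hstrip (S19.shift_of_log ?_)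
      intro k q l hl hH
      obtain ⟨Z, hZ, hZH⟩ := hgen _ hH
      rw [hS] at hZ
      obtain ⟨u, hu, rfl⟩ := hZ
      have hmem : famFiber D (S19.scFun l ∘ u) ∈ S' := by
        rw [hS]
        exact ⟨_, (S19.invariant hΩ hl u).2 hu, rfl⟩
      refine hp.2.2.2.1 _ (hSp hmem) _ (S19.def_HP _ _) ?_
      intro v hv
      obtain ⟨v0, rfl⟩ := S19.exists_sc hl v
      rw [S19.fiber_sc hD hl] at hv
      exact (S19.HP_sc hl v0).2 (hZH hv)
    · intro hpdef
      refine S19.main_contra hdef hp hSp hgen hstrip (S19.shift_of_log ?_)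
      intro k q l hl hH
      obtain ⟨m, D, u, hD, hDu⟩ := S19.exists_params (S19.def_HP k q)
      have h1 : S19.scFun l ∘ u ∈ {u : Fin m → ℝ | famFiber D u ∈ p} := by
        rw [S19.invariant (hpdef m D hD) hl u]
        show famFiber D u ∈ p
        rw [← hDu]
        exact hH
      have h2 : famFiber D (S19.scFun l ∘ u) = S19.HP k (q + Real.log l) := by
        ext v
        obtain ⟨v0, rfl⟩ := S19.exists_sc hl v
        rw [S19.fiber_sc hD hl, S19.HP_sc hl, ← hDu]
      rw [← h2]
      exact h1
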